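/- For every integer n ≥ 3, the space of sl_2-invariant 2-cocycles of the abelian ideal a of g_n = sch_n/⟨z⟩ with values in the adjoint module g_n is zero: every alternating bilinear map φ: a×a→g_n that is sl_2-invariant and satisfies the 2-cocycle identity vanishes identically. -/

import Mathlib

open scoped BigOperators

/-- Basis index set for the Lie algebra `g_n = sch_n/⟨z⟩`, the quotient of the `n`-th
Schrödinger algebra by its center, with basis `{h, e, f, x_1, …, x_n, y_1, …, y_n}`. -/
inductive GIdx (n : ℕ) : Type
  | H : GIdx n
  | E : GIdx n
  | F : GIdx n
  | X : Fin n → GIdx n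
  | Y : Fin n → GIdx n
  deriving DecidableEq

/-- The underlying vector space of `g_n = sch_n/⟨z⟩`. -/
abbrev G (n : ℕ) : Type := GIdx n → ℂ

/-- The Lie bracket of `g_n`, componentwise; it encodes exactly the relations
`[e,f]=h, [h,e]=2e, [h,f]=-2f, [h,x_i]=x_i, [h,y_i]=-y_i, [e,y_i]=x_i, [f,x_i]=y_i`. -/
noncomputable def brg {n : ℕ} (u v : G n) : G n := fun j =>
  match j with
  | .H => u .E * v .F - u .F * v .E
  | .E => 2 * (u .H * v .E - u .E * v .H)
  | .F => -2 * (u .H * v .F - u .F * v .H)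
  | .X i => (u .H * v (.X i) - u (.X i) * v .H) + (u .E * v (.Y i) - u (.Y i) * v .E)
  | .Y i => -(u .H * v (.Y i) - u (.Y i) * v .H) + (u .F * v (.X i) - u (.X i) * v .F)

/-- The bracket of `g_n` as a bilinear map. -/
noncomputable def brgL (n : ℕ) : G n →ₗ[ℂ] G n →ₗ[ℂ] G n :=
  LinearMap.mk₂ ℂ brg
    (by intro m m' v; funext j; cases j <;> simp only [brg, Pi.add_apply] <;> ring)
    (by intro c m v; funext j; cases j <;>
      simp only [brg, Pi.smul_apply, smul_eq_mul] <;> ring)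
    (by intro m v v'; funext j; cases j <;> simp only [brg, Pi.add_apply] <;> ring)
    (by intro c m v; funext j; cases j <;>
      simp only [brg, Pi.smul_apply, smul_eq_mul] <;> ring)

/-- The basis vector `h` of `g_n`. -/
noncomputable def hG (n : ℕ) : G n := Pi.single GIdx.H 1
/-- The basis vector `e` of `g_n`. -/
noncomputable def eG (n : ℕ) : G n := Pi.single GIdx.E 1
/-- The basis vector `f` of `g_n`. -/
noncomputable def fG (n : ℕ) : G n := Pi.single GIdx.F 1
/-- The basis vector `x_i` of `g_n`. -/
noncomputable def xG {n : ℕ} (i : Fin n) : G n := Pi.single (GIdx.X i) 1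
/-- The basis vector `y_i` of `g_n`. -/
noncomputable def yG {n : ℕ} (i : Fin n) : G n := Pi.single (GIdx.Y i) 1

/-- The subalgebra `sl_2 = span {e, f, h}` of `g_n`. -/
noncomputable def sl2G (n : ℕ) : Submodule ℂ (G n) :=
  Submodule.span ℂ {eG n, fG n, hG n}

/-- Basis index set for the abelian ideal `a = span {x_1, …, x_n, y_1, …, y_n}` of `g_n`. -/
inductive AIdx (n : ℕ) : Type
  | X : Fin n → AIdx n
  | Y : Fin n → AIdx n
  deriving DecidableEq

/-- The underlying vector space of the abelian ideal `a` of `g_n`. -/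
abbrev A (n : ℕ) : Type := AIdx n → ℂ

/-- The natural inclusion `a → g_n`. -/
noncomputable def ιA {n : ℕ} (a : A n) : G n := fun j =>
  match j with
  | .X i => a (.X i)
  | .Y i => a (.Y i)
  | .H => 0
  | .E => 0
  | .F => 0

/-- The action of `v ∈ g_n` on the ideal `a`: `actA v a = [v, a]`, viewed inside `a`
(the ideal `a` is stable under taking brackets with any element). -/
noncomputable def actA {n : ℕ} (v : G n) (a : A n) : A n := fun j =>
  match j with
  | .X i => brgL n v (ιA a) (GIdx.X i)
  | .Y i => brgL n v (ιA a) (GIdx.Y i)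

/-- The (zero) bracket of the abelian ideal `a`. -/
noncomputable def brA {n : ℕ} (a b : A n) : A n := actA (ιA a) b

/-- The basis vector `x_i` of `a`. -/
noncomputable def xA {n : ℕ} (i : Fin n) : A n := Pi.single (AIdx.X i) 1
/-- The basis vector `y_i` of `a`. -/
noncomputable def yA {n : ℕ} (i : Fin n) : A n := Pi.single (AIdx.Y i) 1

/-- The index set of `a` is two copies of `Fin n`. -/
def AIdx.equivSum (n : ℕ) : AIdx n ≃ Fin n ⊕ Fin n where
  toFun
    | .X i => .inl i
    | .Y i => .inr i
  invFun
    | .inl i => .X i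
    | .inr i => .Y i
  left_inv a := by cases a <;> rfl
  right_inv s := by cases s <;> rfl

instance AIdx.instFinite (n : ℕ) : Finite (AIdx n) :=
  Finite.of_equiv _ (AIdx.equivSum n).symm

@[simp] theorem brgL_apply {n : ℕ} (u v : G n) : brgL n u v = brg u v := rfl

/-- Linear maps out of `a` agreeing on all `x_i` and `y_i` are equal. -/
theorem A_ext_basis {n : ℕ} {M : Type*} [AddCommMonoid M] [Module ℂ M] {f g : A n →ₗ[ℂ] M}
    (hx : ∀ i, f (xA i) = g (xA i)) (hy : ∀ i, f (yA i) = g (yA i)) : f = g := by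
  refine LinearMap.pi_ext' fun j => LinearMap.ext_ring ?_
  cases j with
  | X i => exact hx i
  | Y i => exact hy i

section Action

variable {n : ℕ} (i : Fin n)

theorem actA_hG_xA : actA (hG n) (xA i) = xA i := by
  funext j; cases j <;> simp [actA, hG, xA, ιA, brg, Pi.single_apply]

theorem actA_hG_yA : actA (hG n) (yA i) = -yA i := by
  funext j; cases j <;> simp [actA, hG, yA, ιA, brg, Pi.single_apply]

theorem actA_eG_xA : actA (eG n) (xA i) = 0 := by
  funext j; cases j <;> simp [actA, eG, xA, ιA, brg, Pi.single_apply]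

theorem actA_eG_yA : actA (eG n) (yA i) = xA i := by
  funext j; cases j <;> simp [actA, eG, xA, yA, ιA, brg, Pi.single_apply]

theorem brA_eq_zero (a b : A n) : brA a b = 0 := by
  funext j; cases j <;> simp [brA, actA, ιA, brg]

end Action

section Weight

variable {n : ℕ} {u : G n}

/-- The weight-`2` space of `g_n` is spanned by `e`. -/
theorem eq_smul_eG_of_weight_two (h : brg (hG n) u = (2 : ℂ) • u) : u = u .E • eG n := by
  funext j
  have := congrFun h j
  cases j <;> simp [brg, hG, eG] at this ⊢ <;> grind

/-- The weight-`0` space of `g_n` is spanned by `h`. -/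
theorem eq_smul_hG_of_weight_zero (h : brg (hG n) u = 0) : u = u .H • hG n := by
  funext j
  have := congrFun h j
  cases j <;> simp [brg, hG] at this ⊢ <;> grind

/-- The weight-`-2` space of `g_n` is spanned by `f`. -/
theorem eq_smul_fG_of_weight_neg_two (h : brg (hG n) u = (-2 : ℂ) • u) :
    u = u .F • fG n := by
  funext j
  have := congrFun h j
  cases j <;> simp [brg, hG, fG] at this ⊢ <;> grind

end Weight

/-- **For every `n ≥ 3`, the space of `sl_2`-invariant 2-cocycles of the abelian ideal
`a` of `g_n = sch_n/⟨z⟩` with values in the adjoint module `g_n` is zero: every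
alternating bilinear `sl_2`-invariant 2-cocycle `φ : a × a → g_n` vanishes. ** -/
theorem adjInvZ2_quotient_eq_zero (n : ℕ) (hn : 3 ≤ n) :
    ∀ φ : A n →ₗ[ℂ] A n →ₗ[ℂ] G n,
      (∀ a, φ a a = 0) →
      (∀ a b c, brgL n (ιA a) (φ b c) + brgL n (ιA b) (φ c a) + brgL n (ιA c) (φ a b) +
        φ a (brA b c) + φ b (brA c a) + φ c (brA a b) = 0) →
      (∀ v ∈ sl2G n, ∀ a b,
        brgL n v (φ a b) - φ (actA v a) b - φ a (actA v b) = 0) →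
      φ = 0 := by
  intro φ halt hcoc hinv
  have hskew (a b : A n) : φ b a = -φ a b := by
    have := halt (a + b)
    simp only [map_add, LinearMap.add_apply, halt, zero_add, add_zero] at this
    exact eq_neg_of_add_eq_zero_left (by rwa [add_comm] at this ⊢)
  have hh := hinv (hG n) (Submodule.subset_span (by simp))
  have he := hinv (eG n) (Submodule.subset_span (by simp))
  have hxx (i j) : φ (xA i) (xA j) = φ (xA i) (xA j) .E • eG n := by
    refine eq_smul_eG_of_weight_two ?_
    have := hh (xA i) (xA j)
    rw [actA_hG_xA, actA_hG_xA, brgL_apply, sub_sub, sub_eq_zero] at this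
    rw [this, two_smul]
  have hxy (i j) : φ (xA i) (yA j) = φ (xA i) (yA j) .H • hG n := by
    refine eq_smul_hG_of_weight_zero ?_
    simpa [actA_hG_xA, actA_hG_yA] using hh (xA i) (yA j)
  have hyy (i j) : φ (yA i) (yA j) = φ (yA i) (yA j) .F • fG n := by
    refine eq_smul_fG_of_weight_neg_two ?_
    have := hh (yA i) (yA j)
    rw [actA_hG_yA, actA_hG_yA, brgL_apply, sub_sub, sub_eq_zero] at this
    rw [this, neg_smul, two_smul]
    simp
  have hxx0 (i j) : φ (xA i) (xA j) = 0 := by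
    rcases eq_or_ne i j with rfl | -
    · exact halt _
    obtain ⟨k, -, hk⟩ : ∃ k ∈ (Finset.univ : Finset (Fin n)), k ∉ ({i, j} : Finset (Fin n)) :=
      Finset.exists_mem_notMem_of_card_lt_card
        (Finset.card_le_two.trans_lt (by rw [Finset.card_fin]; exact hn))
    simp only [Finset.mem_insert, Finset.mem_singleton, not_or] at hk
    have := congrFun (hcoc (xA i) (xA j) (yA k)) (.X k)
    rw [hskew (xA i) (yA k), hxx i j, hxy i k, hxy j k] at this
    rw [hxx i j]
    simpa [brA_eq_zero, brg, ιA, xA, yA, hG, eG, Pi.single_apply, hk.1, hk.2] using this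
  have hxy0 (i j) : φ (xA i) (yA j) = 0 := by
    have := congrFun (he (xA i) (yA j)) .E
    rw [actA_eG_xA, actA_eG_yA, hxx0, hxy i j] at this
    rw [hxy i j]
    simpa [brg, hG, eG] using this
  have hyx0 (i j) : φ (yA i) (xA j) = 0 := by rw [hskew (xA j), hxy0, neg_zero]
  have hyy0 (i j) : φ (yA i) (yA j) = 0 := by
    have := congrFun (he (yA i) (yA j)) .H
    rw [actA_eG_yA, actA_eG_yA, hxy0, hyx0, hyy i j] at this
    rw [hyy i j]
    simpa [brg, fG, eG] using this
  exact A_ext_basis (fun i => A_ext_basis (hxx0 i) (hxy0 i))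
    fun i => A_ext_basis (hyx0 i) (hyy0 i)
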